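/- Let A, B ⊆ ℕ, and let U be the set of parameter pairs (u,v) with u,v > 0 such that D̄(A ∩ ⌊uB + v⌋) ≤ max(0, D̄(A) + D̄(B) − 1). Then the Lebesgue (outer) measure of U ∩ [0,M]² divided by M² tends to 1 as M → ∞. -/

import Mathlib

open Filter MeasureTheory Set

/-- The mass dimension of `A ⊆ ℕ`: `limsup_{N → ∞} log |A ∩ {1,…,N}| / log N`. -/
noncomputable def massDimN (A : Set ℕ) : ℝ :=
  Filter.limsup (fun N : ℕ =>
    Real.log ((A ∩ Set.Icc 1 N).ncard) / Real.log N) Filter.atTop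

/-- The set `A ∩ ⌊u·B + v⌋ = {a ∈ A : ∃ b ∈ B, a = ⌊u·b + v⌋}`. -/
def interFloor (A B : Set ℕ) (u v : ℝ) : Set ℕ :=
  {a ∈ A | ∃ b ∈ B, (a : ℤ) = ⌊u * (b : ℝ) + v⌋}

theorem ncard_le_self (A : Set ℕ) (N : ℕ) : (A ∩ Set.Icc 1 N).ncard ≤ N := by
  calc (A ∩ Set.Icc 1 N).ncard ≤ (Set.Icc 1 N).ncard :=
        Set.ncard_le_ncard Set.inter_subset_right (Set.finite_Icc 1 N)
    _ = N := by
        rw [← Finset.coe_Icc, Set.ncard_coe_finset]; simp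

theorem ratio_nonneg (A : Set ℕ) (N : ℕ) :
    0 ≤ Real.log ((A ∩ Set.Icc 1 N).ncard) / Real.log N :=
  div_nonneg (Real.log_natCast_nonneg _) (Real.log_natCast_nonneg _)

theorem ratio_le_one (A : Set ℕ) (N : ℕ) :
    Real.log ((A ∩ Set.Icc 1 N).ncard) / Real.log N ≤ 1 := by
  apply div_le_one_of_le₀ _ (Real.log_natCast_nonneg _)
  rcases Nat.eq_zero_or_pos (A ∩ Set.Icc 1 N).ncard with h | h
  · rw [h]; simpa using Real.log_natCast_nonneg N
  · exact Real.log_le_log (by exact_mod_cast h) (by exact_mod_cast ncard_le_self A N)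

theorem massDimN_nonneg (A : Set ℕ) : 0 ≤ massDimN A := by
  unfold massDimN
  refine Filter.le_limsup_of_frequently_le ?_ ?_
  · exact (Filter.Eventually.of_forall (fun N => ratio_nonneg A N)).frequently
  · exact Filter.isBoundedUnder_of ⟨1, fun N => ratio_le_one A N⟩

theorem massDimN_le_of_bound (A : Set ℕ) (s C : ℝ) (hC : 1 ≤ C) (hs : 0 ≤ s)
    (h : ∀ N : ℕ, 1 ≤ N → ((A ∩ Set.Icc 1 N).ncard : ℝ) ≤ C * (N : ℝ) ^ s) :
    massDimN A ≤ s := by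
  apply le_of_forall_pos_le_add
  intro η hη
  unfold massDimN
  refine Filter.limsup_le_of_le ?_ ?_
  · exact Filter.IsCoboundedUnder.of_frequently_ge (a := 0)
      (Filter.Eventually.of_forall (fun N => ratio_nonneg A N)).frequently
  · have hlog : Tendsto (fun N : ℕ => Real.log (N : ℝ)) atTop atTop :=
      Real.tendsto_log_atTop.comp tendsto_natCast_atTop_atTop
    filter_upwards [hlog.eventually_ge_atTop (Real.log C / η), eventually_ge_atTop 2] with N h1 h2
    have hN : (0 : ℝ) < N := by positivity
    have hlN : 0 < Real.log N := Real.log_pos (by exact_mod_cast h2)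
    rw [div_le_iff₀ hlN]
    rw [div_le_iff₀ hη] at h1
    rcases Nat.eq_zero_or_pos (A ∩ Set.Icc 1 N).ncard with h0 | h0
    · rw [h0]; simp; positivity
    · calc Real.log ((A ∩ Set.Icc 1 N).ncard) ≤ Real.log (C * (N : ℝ) ^ s) :=
            Real.log_le_log (by exact_mod_cast h0) (h N (by omega))
        _ = Real.log C + s * Real.log N := by
            rw [Real.log_mul (by positivity) (by positivity), Real.log_rpow hN]
        _ ≤ _ := by nlinarith

theorem exists_bound_of_massDimN_lt (A : Set ℕ) (t : ℝ) (ht : massDimN A < t) :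
    ∃ C : ℝ, 0 < C ∧ ∀ N : ℕ, 1 ≤ N → ((A ∩ Set.Icc 1 N).ncard : ℝ) ≤ C * (N : ℝ) ^ t := by
  have ht0 : 0 < t := lt_of_le_of_lt (massDimN_nonneg A) ht
  have hev := Filter.eventually_lt_of_limsup_lt (f := atTop) ht
    (Filter.isBoundedUnder_of ⟨1, fun N => ratio_le_one A N⟩)
  obtain ⟨N0, hN0⟩ := eventually_atTop.1 hev
  refine ⟨N0 + 2, by positivity, fun N hN => ?_⟩
  have hNr : (1 : ℝ) ≤ N := by exact_mod_cast hN
  have hp : (1 : ℝ) ≤ (N : ℝ) ^ t := Real.one_le_rpow hNr ht0.le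
  have hself : ((A ∩ Set.Icc 1 N).ncard : ℝ) ≤ N := by exact_mod_cast ncard_le_self A N
  by_cases hc : N < N0 + 2
  · have : (N : ℝ) ≤ N0 + 2 := by exact_mod_cast hc.le
    nlinarith
  · have h1 := hN0 N (by omega)
    have hlN : 0 < Real.log N := Real.log_pos (by exact_mod_cast (by omega : 1 < N))
    rw [div_lt_iff₀ hlN, ← Real.log_rpow (by linarith)] at h1
    have h2 : ((A ∩ Set.Icc 1 N).ncard : ℝ) ≤ (N : ℝ) ^ t := by
      rcases Nat.eq_zero_or_pos (A ∩ Set.Icc 1 N).ncard with h0 | h0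
      · rw [h0]; simp; positivity
      · exact ((Real.log_lt_log_iff (by exact_mod_cast h0) (by positivity)).1 h1).le
    have : (0 : ℝ) ≤ N0 := by positivity
    nlinarith

theorem summable_of_massDimN_lt (A : Set ℕ) (s : ℝ) (hs : massDimN A < s) :
    Summable (fun a : {a : ℕ // a ∈ A ∧ 1 ≤ a} => ((a : ℕ) : ℝ) ^ (-s)) := by
  obtain ⟨t, ht, hts⟩ := exists_between hs
  have ht0 : 0 < t := lt_of_le_of_lt (massDimN_nonneg A) ht
  obtain ⟨C, hC, hb⟩ := exists_bound_of_massDimN_lt A t ht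
  let c : {a : ℕ // a ∈ A ∧ 1 ≤ a} → ℕ := fun a => (A ∩ Set.Icc 1 (a : ℕ)).ncard
  have hmono : StrictMono c := by
    intro a b hab
    have hab' : (a : ℕ) < b := hab
    apply Set.ncard_lt_ncard _ ((Set.finite_Icc 1 (b : ℕ)).inter_of_right A)
    refine ⟨fun x hx => ⟨hx.1, hx.2.1, hx.2.2.trans hab'.le⟩, fun hsub => ?_⟩
    have := hsub ⟨b.2.1, b.2.2, le_refl _⟩
    exact absurd this.2.2 (not_le.2 hab')
  have hsum : Summable (fun n : ℕ => C ^ (s / t) * (n : ℝ) ^ (-(s / t))) := by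
    apply Summable.mul_left
    rw [Real.summable_nat_rpow]
    have : 1 < s / t := by rwa [one_lt_div ht0]
    linarith
  refine Summable.of_nonneg_of_le (fun a => by positivity) (fun a => ?_)
    (hsum.comp_injective hmono.injective)
  have ha1 : (1 : ℝ) ≤ (a : ℕ) := by exact_mod_cast a.2.2
  have hcpos : 0 < c a := by
    apply (Set.ncard_pos ((Set.finite_Icc 1 (a : ℕ)).inter_of_right A)).2
    exact ⟨a, a.2.1, a.2.2, le_refl _⟩
  have hcp : (0 : ℝ) < c a := by exact_mod_cast hcpos
  have h1 : (c a : ℝ) ≤ C * ((a : ℕ) : ℝ) ^ t := hb a a.2.2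
  have hst : 0 < s / t := div_pos (ht0.trans hts) ht0
  have h2 : (c a : ℝ) ^ (s / t) ≤ C ^ (s / t) * ((a : ℕ) : ℝ) ^ s := by
    calc (c a : ℝ) ^ (s / t) ≤ (C * ((a : ℕ) : ℝ) ^ t) ^ (s / t) :=
          Real.rpow_le_rpow hcp.le h1 hst.le
      _ = _ := by
          rw [Real.mul_rpow hC.le (by positivity), ← Real.rpow_mul (by positivity)]
          congr 2; field_simp
  show ((a : ℕ) : ℝ) ^ (-s) ≤ C ^ (s / t) * (c a : ℝ) ^ (-(s / t))
  rw [Real.rpow_neg (by positivity), Real.rpow_neg hcp.le]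
  have hx : (0 : ℝ) < ((a : ℕ) : ℝ) ^ s := by positivity
  have hy : (0 : ℝ) < (c a : ℝ) ^ (s / t) := by positivity
  rw [← div_eq_mul_inv, le_div_iff₀ hy, inv_mul_le_iff₀ hx]
  linarith

/-- Parameters in the box for which `a = ⌊u b + v⌋`. -/
def boxSet (K : ℝ) (a b : ℕ) : Set (ℝ × ℝ) :=
  {p | (p.1 ∈ Set.Icc (1 / K) K ∧ p.2 ∈ Set.Icc 0 K) ∧ (a : ℤ) = ⌊p.1 * (b : ℝ) + p.2⌋}

theorem measurableSet_boxSet (K : ℝ) (a b : ℕ) : MeasurableSet (boxSet K a b) := by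
  unfold boxSet
  apply MeasurableSet.inter
  · exact (measurable_fst measurableSet_Icc).inter (measurable_snd measurableSet_Icc)
  · exact measurableSet_eq_fun measurable_const (Int.measurable_floor.comp (by fun_prop))

theorem volume_boxSet_le (K : ℝ) (hK : 1 ≤ K) (a b : ℕ) (hb : 1 ≤ b) :
    volume (boxSet K a b) ≤ ENNReal.ofReal (K / b) := by
  have hb0 : (0 : ℝ) < b := by exact_mod_cast hb
  rw [Measure.volume_eq_prod, Measure.prod_apply_symm (measurableSet_boxSet K a b)]
  calc ∫⁻ y, volume ((fun x : ℝ => (x, y)) ⁻¹' boxSet K a b)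
      ≤ ∫⁻ y, (Set.Icc (0 : ℝ) K).indicator (fun _ => ENNReal.ofReal (1 / b)) y := by
        apply lintegral_mono
        intro y
        by_cases hy : y ∈ Set.Icc (0 : ℝ) K
        · simp only [Set.indicator_of_mem hy]
          calc volume ((fun x : ℝ => (x, y)) ⁻¹' boxSet K a b)
              ≤ volume (Set.Icc (((a : ℝ) - y) / b) (((a : ℝ) + 1 - y) / b)) := by
                apply measure_mono
                intro x hx
                have h2 : (a : ℤ) = ⌊x * (b : ℝ) + y⌋ := hx.2
                have h3 := Int.floor_eq_iff.1 h2.symm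
                push_cast at h3
                constructor
                · rw [div_le_iff₀ hb0]; linarith [h3.1]
                · rw [le_div_iff₀ hb0]; linarith [h3.2]
            _ = ENNReal.ofReal (1 / b) := by
                rw [Real.volume_Icc]; congr 1; field_simp; ring
        · simp only [Set.indicator_of_notMem hy]
          have : (fun x : ℝ => (x, y)) ⁻¹' boxSet K a b = ∅ := by
            ext x; simp only [Set.mem_preimage, Set.mem_empty_iff_false, iff_false]
            exact fun h => hy h.1.2
          rw [this]; simp
    _ = ENNReal.ofReal (K / b) := by
        rw [lintegral_indicator measurableSet_Icc, lintegral_const]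
        simp only [Measure.restrict_apply MeasurableSet.univ, Set.univ_inter, Real.volume_Icc]
        rw [← ENNReal.ofReal_mul (by positivity)]
        congr 1; field_simp; ring

theorem boxSet_comparable (K : ℝ) (hK : 1 ≤ K) (a b : ℕ) (ha : 1 ≤ a) (hb : 1 ≤ b)
    (h : (boxSet K a b).Nonempty) : (a : ℝ) ≤ 2 * K * b ∧ (b : ℝ) ≤ 2 * K * a := by
  obtain ⟨⟨u, v⟩, ⟨⟨hu1, hu2⟩, hv1, hv2⟩, he⟩ := h
  have h3 := Int.floor_eq_iff.1 he.symm
  push_cast at h3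
  simp only at hu1 hu2 hv1 hv2 h3
  have ha1 : (1 : ℝ) ≤ a := by exact_mod_cast ha
  have hb1 : (1 : ℝ) ≤ b := by exact_mod_cast hb
  have hK0 : 0 < K := by linarith
  constructor
  · nlinarith
  · have : (b : ℝ) ≤ K * (u * b) := by
      rw [div_le_iff₀ hK0] at hu1
      nlinarith
    have : u * b ≤ 2 * a := by linarith [h3.2]
    nlinarith

/-- The pointwise estimate for each term. -/
theorem term_bound (K s s1 s2 : ℝ) (hK : 1 ≤ K) (hs1 : 0 ≤ s1) (hs : 0 ≤ s)
    (hss : s1 + s2 ≤ 1 + s) (a b : ℕ) (ha : 1 ≤ a) (hb : 1 ≤ b) :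
    volume (boxSet K a b) * ENNReal.ofReal ((a : ℝ) ^ (-s)) ≤
      ENNReal.ofReal (K * (2 * K) ^ (s + s1)) *
        (ENNReal.ofReal ((a : ℝ) ^ (-s1)) * ENNReal.ofReal ((b : ℝ) ^ (-s2))) := by
  rcases Set.eq_empty_or_nonempty (boxSet K a b) with h | h
  · rw [h]; simp
  obtain ⟨h1, h2⟩ := boxSet_comparable K hK a b ha hb h
  have ha1 : (1 : ℝ) ≤ a := by exact_mod_cast ha
  have hb1 : (1 : ℝ) ≤ b := by exact_mod_cast hb
  have hK0 : 0 < K := by linarith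
  have ha0 : (0 : ℝ) < a := by linarith
  have hb0 : (0 : ℝ) < b := by linarith
  calc volume (boxSet K a b) * ENNReal.ofReal ((a : ℝ) ^ (-s))
      ≤ ENNReal.ofReal (K / b) * ENNReal.ofReal ((a : ℝ) ^ (-s)) := by
        gcongr; exact volume_boxSet_le K hK a b hb
    _ = ENNReal.ofReal (K / b * (a : ℝ) ^ (-s)) := by rw [ENNReal.ofReal_mul (by positivity)]
    _ ≤ ENNReal.ofReal (K * (2 * K) ^ (s + s1) * ((a : ℝ) ^ (-s1) * (b : ℝ) ^ (-s2))) := by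
        apply ENNReal.ofReal_le_ofReal
        have e1 : (a : ℝ) ^ (-s) ≤ (2 * K) ^ s * (b : ℝ) ^ (-s) := by
          have : (b : ℝ) ^ s ≤ (2 * K) ^ s * (a : ℝ) ^ s := by
            rw [← Real.mul_rpow (by positivity) (by positivity)]
            exact Real.rpow_le_rpow hb0.le h2 hs
          rw [Real.rpow_neg ha0.le, Real.rpow_neg hb0.le, ← div_eq_mul_inv,
            le_div_iff₀ (by positivity), inv_mul_le_iff₀ (by positivity)]
          linarith
        have e2 : (b : ℝ) ^ (-s1) ≤ (2 * K) ^ s1 * (a : ℝ) ^ (-s1) := by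
          have : (a : ℝ) ^ s1 ≤ (2 * K) ^ s1 * (b : ℝ) ^ s1 := by
            rw [← Real.mul_rpow (by positivity) (by positivity)]
            exact Real.rpow_le_rpow ha0.le h1 hs1
          rw [Real.rpow_neg ha0.le, Real.rpow_neg hb0.le, ← div_eq_mul_inv,
            le_div_iff₀ (by positivity), inv_mul_le_iff₀ (by positivity)]
          linarith
        have e3 : (b : ℝ)⁻¹ * (b : ℝ) ^ (-s) ≤ (b : ℝ) ^ (-s1) * (b : ℝ) ^ (-s2) := by
          rw [← Real.rpow_neg_one, ← Real.rpow_add hb0, ← Real.rpow_add hb0]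
          exact Real.rpow_le_rpow_of_exponent_le hb1 (by linarith)
        calc K / b * (a : ℝ) ^ (-s) ≤ K / b * ((2 * K) ^ s * (b : ℝ) ^ (-s)) := by gcongr
          _ = K * (2 * K) ^ s * ((b : ℝ)⁻¹ * (b : ℝ) ^ (-s)) := by ring
          _ ≤ K * (2 * K) ^ s * ((b : ℝ) ^ (-s1) * (b : ℝ) ^ (-s2)) := by gcongr
          _ ≤ K * (2 * K) ^ s * (((2 * K) ^ s1 * (a : ℝ) ^ (-s1)) * (b : ℝ) ^ (-s2)) := by gcongr
          _ = _ := by rw [Real.rpow_add (by positivity)]; ring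
    _ = _ := by
        rw [ENNReal.ofReal_mul (p := K * (2 * K) ^ (s + s1)) (by positivity),
          ENNReal.ofReal_mul (p := (a : ℝ) ^ (-s1)) (by positivity)]

/-- The weighted counting function. -/
noncomputable def wsum (A B : Set ℕ) (K s : ℝ) (p : ℝ × ℝ) : ENNReal :=
  ∑' a : {a : ℕ // a ∈ A ∧ 1 ≤ a}, ∑' b : {b : ℕ // b ∈ B ∧ 1 ≤ b},
    (boxSet K a b).indicator (fun _ => ENNReal.ofReal (((a : ℕ) : ℝ) ^ (-s))) p

theorem ae_wsum_lt_top (A B : Set ℕ) (K s : ℝ) (hK : 1 ≤ K)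
    (hs : max 0 (massDimN A + massDimN B - 1) < s) :
    ∀ᵐ p : ℝ × ℝ, wsum A B K s p < ⊤ := by
  have hmeas : ∀ (a : {a : ℕ // a ∈ A ∧ 1 ≤ a}) (b : {b : ℕ // b ∈ B ∧ 1 ≤ b}),
      Measurable ((boxSet K a b).indicator
        (fun _ : ℝ × ℝ => ENNReal.ofReal (((a : ℕ) : ℝ) ^ (-s)))) :=
    fun a b => measurable_const.indicator (measurableSet_boxSet K a b)
  have hs0 : 0 < s := lt_of_le_of_lt (le_max_left _ _) hs
  have hs' : massDimN A + massDimN B - 1 < s := lt_of_le_of_lt (le_max_right _ _) hs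
  set ε := (1 + s - massDimN A - massDimN B) / 2 with hε
  have hε0 : 0 < ε := by rw [hε]; linarith
  have hA := summable_of_massDimN_lt A (massDimN A + ε) (by linarith)
  have hB := summable_of_massDimN_lt B (massDimN B + ε) (by linarith)
  have hA' := hA.tsum_ofReal_ne_top
  have hB' := hB.tsum_ofReal_ne_top
  refine ae_lt_top (Measurable.ennreal_tsum fun a => Measurable.ennreal_tsum fun b => hmeas a b) ?_
  apply ne_top_of_le_ne_top (b := ENNReal.ofReal (K * (2 * K) ^ (s + (massDimN A + ε))) *
    ((∑' a : {a : ℕ // a ∈ A ∧ 1 ≤ a}, ENNReal.ofReal (((a : ℕ) : ℝ) ^ (-(massDimN A + ε)))) *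
     (∑' b : {b : ℕ // b ∈ B ∧ 1 ≤ b}, ENNReal.ofReal (((b : ℕ) : ℝ) ^ (-(massDimN B + ε))))))
  · exact ENNReal.mul_ne_top ENNReal.ofReal_ne_top (ENNReal.mul_ne_top hA' hB')
  · unfold wsum
    rw [lintegral_tsum (fun a => (Measurable.ennreal_tsum fun b => hmeas a b).aemeasurable)]
    rw [← ENNReal.tsum_mul_right, ← ENNReal.tsum_mul_left]
    apply ENNReal.tsum_le_tsum
    intro a
    rw [lintegral_tsum (fun b => (hmeas a b).aemeasurable)]
    rw [← ENNReal.tsum_mul_left, ← ENNReal.tsum_mul_left]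
    apply ENNReal.tsum_le_tsum
    intro b
    rw [lintegral_indicator (measurableSet_boxSet K a b), lintegral_const,
      Measure.restrict_apply MeasurableSet.univ, Set.univ_inter, mul_comm]
    exact term_bound K s _ _ hK (by linarith [massDimN_nonneg A]) hs0.le
      (by rw [hε]; linarith) a b a.2.2 b.2.2

theorem massDimN_le_of_wsum (A B : Set ℕ) (K s : ℝ) (hs : 0 ≤ s) (p : ℝ × ℝ)
    (hp1 : p.1 ∈ Set.Icc (1 / K) K) (hp2 : p.2 ∈ Set.Icc 0 K)
    (h : wsum A B K s p < ⊤) : massDimN (interFloor A B p.1 p.2) ≤ s := by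
  set S := (wsum A B K s p).toReal with hS
  have hS0 : 0 ≤ S := ENNReal.toReal_nonneg
  apply massDimN_le_of_bound _ s (S + 1) (by linarith) hs
  intro N hN
  have hN1 : (1 : ℝ) ≤ N := by exact_mod_cast hN
  have hNs : (1 : ℝ) ≤ (N : ℝ) ^ s := Real.one_le_rpow hN1 hs
  have hfin : (interFloor A B p.1 p.2 ∩ Set.Icc 1 N).Finite :=
    (Set.finite_Icc 1 N).inter_of_right _
  classical
  let F : Finset ℕ := hfin.toFinset.erase ⌊p.2⌋.toNat
  have hF : ∀ a ∈ F, (a ∈ A ∧ 1 ≤ a) ∧ a ≤ N ∧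
      ∃ b : {b : ℕ // b ∈ B ∧ 1 ≤ b}, p ∈ boxSet K a b := by
    intro a ha
    obtain ⟨hne, ha⟩ := Finset.mem_erase.1 ha
    rw [Set.Finite.mem_toFinset] at ha
    obtain ⟨⟨haA, b, hbB, hab⟩, ha1, haN⟩ := ha
    refine ⟨⟨haA, ha1⟩, haN, ⟨b, hbB, ?_⟩, ⟨hp1, hp2⟩, hab⟩
    by_contra hb
    have hb0 : b = 0 := by omega
    subst hb0
    simp at hab
    apply hne
    rw [← hab]; simp
  have hcard : (interFloor A B p.1 p.2 ∩ Set.Icc 1 N).ncard ≤ F.card + 1 := by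
    rw [Set.ncard_eq_toFinset_card _ hfin]
    have := Finset.pred_card_le_card_erase (s := hfin.toFinset) (a := ⌊p.2⌋.toNat)
    show _ ≤ (hfin.toFinset.erase ⌊p.2⌋.toNat).card + 1
    omega
  let G : Finset {a : ℕ // a ∈ A ∧ 1 ≤ a} := F.subtype _
  have hG : G.card = F.card := by
    rw [Finset.card_subtype, Finset.filter_true_of_mem (fun a ha => (hF a ha).1)]
  have hle : (F.card : ENNReal) * ENNReal.ofReal ((N : ℝ) ^ (-s)) ≤ wsum A B K s p := by
    calc (F.card : ENNReal) * ENNReal.ofReal ((N : ℝ) ^ (-s))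
        = ∑ a ∈ G, ENNReal.ofReal ((N : ℝ) ^ (-s)) := by
          rw [Finset.sum_const, hG, nsmul_eq_mul]
      _ ≤ ∑ a ∈ G, ∑' b : {b : ℕ // b ∈ B ∧ 1 ≤ b},
            (boxSet K a b).indicator (fun _ => ENNReal.ofReal (((a : ℕ) : ℝ) ^ (-s))) p := by
          apply Finset.sum_le_sum
          intro a ha
          obtain ⟨_, haN, b, hb⟩ := hF a (Finset.mem_subtype.1 ha)
          refine le_trans ?_ (ENNReal.le_tsum b)
          rw [Set.indicator_of_mem hb]
          apply ENNReal.ofReal_le_ofReal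
          exact Real.rpow_le_rpow_of_nonpos (by exact_mod_cast a.2.2) (by exact_mod_cast haN)
            (by linarith)
      _ ≤ wsum A B K s p := ENNReal.sum_le_tsum G
  have hle2 : (F.card : ℝ) * (N : ℝ) ^ (-s) ≤ S := by
    have := ENNReal.toReal_mono h.ne hle
    rwa [ENNReal.toReal_mul, ENNReal.toReal_natCast, ENNReal.toReal_ofReal (by positivity)] at this
  rw [Real.rpow_neg (by positivity), ← div_eq_mul_inv, div_le_iff₀ (by positivity)] at hle2
  have : ((interFloor A B p.1 p.2 ∩ Set.Icc 1 N).ncard : ℝ) ≤ F.card + 1 := by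
    exact_mod_cast hcard
  nlinarith

theorem ae_good (A B : Set ℕ) : ∀ᵐ p : ℝ × ℝ, 0 < p.1 → 0 < p.2 →
    massDimN (interFloor A B p.1 p.2) ≤ max 0 (massDimN A + massDimN B - 1) := by
  have h : ∀ᵐ p : ℝ × ℝ, ∀ k n : ℕ, wsum A B ((k : ℝ) + 1)
      (max 0 (massDimN A + massDimN B - 1) + 1 / ((n : ℝ) + 1)) p < ⊤ := by
    rw [ae_all_iff]; intro k
    rw [ae_all_iff]; intro n
    apply ae_wsum_lt_top
    · have : (0 : ℝ) ≤ k := by positivity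
      linarith
    · have : 0 < 1 / ((n : ℝ) + 1) := by positivity
      linarith
  filter_upwards [h] with p hp h1 h2
  obtain ⟨k, hk⟩ := exists_nat_ge (max (max p.1 p.2) (1 / p.1))
  have hk1 : p.1 ≤ k := le_trans (le_trans (le_max_left _ _) (le_max_left _ _)) hk
  have hk2 : p.2 ≤ k := le_trans (le_trans (le_max_right _ _) (le_max_left _ _)) hk
  have hk3 : 1 / p.1 ≤ k := le_trans (le_max_right _ _) hk
  apply le_of_forall_pos_le_add
  intro η hη
  obtain ⟨n, hn⟩ := exists_nat_one_div_lt hη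
  refine le_trans (massDimN_le_of_wsum A B ((k : ℝ) + 1) _ ?_ p ⟨?_, by linarith⟩
    ⟨h2.le, by linarith⟩ (hp k n)) (by linarith)
  · have := le_max_left 0 (massDimN A + massDimN B - 1)
    positivity
  · rw [div_le_iff₀ (by positivity)]
    rw [div_le_iff₀ h1] at hk3
    nlinarith

/-- Weak (asymptotic) slicing corollary for the Cartesian grid: for
`A, B ⊆ ℕ`, the set `U` of parameters `(u,v)` with `u,v > 0` for which
`D̄(A ∩ ⌊uB + v⌋) ≤ max(0, D̄(A) + D̄(B) - 1)` satisfies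
`|U ∩ [0,M]²| / M² → 1` as `M → ∞` (Lebesgue measure). -/
theorem weak_real_grid (A B : Set ℕ) :
    Filter.Tendsto (fun M : ℝ =>
      (MeasureTheory.volume
        ({uv : ℝ × ℝ | 0 < uv.1 ∧ 0 < uv.2 ∧
            massDimN (interFloor A B uv.1 uv.2) ≤
              max 0 (massDimN A + massDimN B - 1)} ∩
          (Set.Icc 0 M ×ˢ Set.Icc 0 M))).toReal / M ^ 2)
      Filter.atTop (nhds 1) := by
  apply tendsto_const_nhds.congr'
  filter_upwards [eventually_gt_atTop 0] with M hM
  have hvol : MeasureTheory.volume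
        ({uv : ℝ × ℝ | 0 < uv.1 ∧ 0 < uv.2 ∧
            massDimN (interFloor A B uv.1 uv.2) ≤
              max 0 (massDimN A + massDimN B - 1)} ∩
          (Set.Icc 0 M ×ˢ Set.Icc 0 M)) = ENNReal.ofReal M * ENNReal.ofReal M := by
    apply le_antisymm
    · refine (measure_mono Set.inter_subset_right).trans ?_
      rw [Measure.volume_eq_prod, Measure.prod_prod, Real.volume_Icc, sub_zero]
    · have : volume (Set.Ioc (0 : ℝ) M ×ˢ Set.Ioc (0 : ℝ) M) =
          ENNReal.ofReal M * ENNReal.ofReal M := by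
        rw [Measure.volume_eq_prod, Measure.prod_prod, Real.volume_Ioc, sub_zero]
      rw [← this]
      apply measure_mono_ae
      filter_upwards [ae_good A B] with p hp hmem
      obtain ⟨⟨h1, h2⟩, h3, h4⟩ := hmem
      exact ⟨⟨h1, h3, hp h1 h3⟩, ⟨h1.le, h2⟩, h3.le, h4⟩
  rw [hvol, ENNReal.toReal_mul, ENNReal.toReal_ofReal hM.le]
  field_simp
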